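/- Let E and F_1,…,F_n be Caccioppoli N-partitions of ℝ^d, let R > 0 and x_1,…,x_n ∈ ℝ^d be such that the balls B_R(x_i) are pairwise disjoint, and let B be any ball or B = ℝ^d. For ρ ≤ R define the N-tuple G_ρ := (E \ ⋃_{i=1}^n (B_ρ(x_i) ∩ B)) ∪ ⋃_{i=1}^n (F_i ∩ B_ρ(x_i) ∩ B) (operations componentwise). Then for every 0 < r < R, the set of ρ ∈ (r,R) such that Σ_{i=1}^n Per(G_ρ, ∂B_ρ(x_i) ∩ B) ≤ Σ_{i=1}^n ‖m((E △ F_i) ∩ (B_R(x_i) \ B_r(x_i)) ∩ B)‖₁ / (2(R−r)) has positive Lebesgue measure, where ‖v‖₁ = Σ_k |v_k| denotes the ℓ¹-norm and m(·) the vector of Lebesgue measures of the components. -/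

import Mathlib

open MeasureTheory Metric Set Filter Topology
open scoped ENNReal symmDiff RealInnerProductSpace

noncomputable section

/-- `d`-dimensional Euclidean space. -/
abbrev Euc (d : ℕ) : Type := EuclideanSpace ℝ (Fin d)

/-- The divergence of a vector field `φ : ℝ^d → ℝ^d`. -/
def vdiv {d : ℕ} (φ : Euc d → Euc d) (x : Euc d) : ℝ :=
  ∑ i, fderiv ℝ φ x (EuclideanSpace.single i 1) i

/-- The perimeter `Per(E, B) = |D 1_E|(B)` of `E` relative to `B`, defined as the
outer-regularized total variation (on `B`) of the distributional derivative of the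
characteristic function of `E`. -/
def perim {d : ℕ} (E B : Set (Euc d)) : ℝ≥0∞ :=
  ⨅ (U : Set (Euc d)) (_ : IsOpen U) (_ : B ⊆ U),
    ⨆ (φ : Euc d → Euc d) (_ : ContDiff ℝ 1 φ) (_ : HasCompactSupport φ)
      (_ : tsupport φ ⊆ U) (_ : ∀ x, ‖φ x‖ ≤ 1),
      ENNReal.ofReal (∫ x in E, vdiv φ x)

/-- A Caccioppoli set: a measurable set with locally finite perimeter. -/
def Caccioppoli {d : ℕ} (E : Set (Euc d)) : Prop :=
  MeasurableSet E ∧ ∀ r : ℝ, 0 < r → perim E (ball 0 r) < ⊤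

/-- An `N`-partition of `ℝ^d`: measurable regions, pairwise Lebesgue-disjoint,
whose union has full measure. -/
structure IsPartition {d N : ℕ} (E : Fin N → Set (Euc d)) : Prop where
  meas : ∀ j, MeasurableSet (E j)
  disj : ∀ i j, i ≠ j → volume (E i ∩ E j) = 0
  full : volume ((univ : Set (Euc d)) \ ⋃ j, E j) = 0

/-- Perimeter of a partition in `B`: half the sum of the perimeters of the regions. -/
def partPerim {d N : ℕ} (E : Fin N → Set (Euc d)) (B : Set (Euc d)) : ℝ≥0∞ :=
  (∑ k, perim (E k) B) / 2

/-- `E` is `J`-isoperimetric in the (closed) set `X`. -/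
def IsJIsoperimetric {d N : ℕ} (E : Fin N → Set (Euc d)) (X : Set (Euc d))
    (J : Set (Fin N)) : Prop :=
  ∀ K : Set (Euc d), IsCompact K → K ⊆ X →
    ∀ F : Fin N → Set (Euc d), IsPartition F →
      (∀ j, (F j) ∆ (E j) ⊆ K) →
      (∀ j ∈ J, volume (F j ∩ K) = volume (E j ∩ K)) →
      partPerim E K ≤ partPerim F K

/-- `E` is isoperimetric: `J`-isoperimetric in `ℝ^d` with `J` the finite-volume regions. -/
def IsIsoperimetric {d N : ℕ} (E : Fin N → Set (Euc d)) : Prop :=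
  IsJIsoperimetric E univ {j | volume (E j) ≠ ⊤}

/-- `L¹_loc` convergence of a family of sets along a filter. -/
def SetTendstoL1loc {d : ℕ} {ι : Type*} (l : Filter ι) (A : ι → Set (Euc d))
    (A' : Set (Euc d)) : Prop :=
  ∀ B : Set (Euc d), MeasurableSet B → Bornology.IsBounded B →
    Tendsto (fun n => volume ((A n ∆ A') ∩ B)) l (𝓝 0)

/-- `L¹_loc` convergence of partitions. -/
def PartTendstoL1loc {d N : ℕ} {ι : Type*} (l : Filter ι) (E : ι → Fin N → Set (Euc d))
    (F : Fin N → Set (Euc d)) : Prop :=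
  ∀ j, SetTendstoL1loc l (fun n => E n j) (F j)

/-- The translate `E - x`. -/
def tr {d : ℕ} (E : Set (Euc d)) (x : Euc d) : Set (Euc d) := (fun y => y + x) ⁻¹' E

/-- The dilation `E / r`. -/
def dil {d : ℕ} (E : Set (Euc d)) (r : ℝ) : Set (Euc d) := (fun y => r • y) ⁻¹' E

/-- A (positively homogeneous) cone with vertex at the origin. -/
def IsCone {d : ℕ} (C : Set (Euc d)) : Prop := ∀ t : ℝ, 0 < t → ∀ x ∈ C, t • x ∈ C

/-- The measure-theoretic representative of a set: its points of essential closure. -/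
def essCl {d : ℕ} (E : Set (Euc d)) : Set (Euc d) :=
  {x | ∀ r > 0, 0 < volume (E ∩ ball x r)}

/-- Admissible test fields for the total variation in `U`. -/
structure IsTestField {d : ℕ} (U : Set (Euc d)) (φ : Euc d → Euc d) : Prop where
  contDiff : ContDiff ℝ 1 φ
  hasCompactSupport : HasCompactSupport φ
  tsupport_subset : tsupport φ ⊆ U
  norm_le : ∀ x, ‖φ x‖ ≤ 1

/-- The total variation in `U` of the distributional derivative of `1_E`. -/
def variation {d : ℕ} (E U : Set (Euc d)) : ℝ≥0∞ :=
  ⨆ (φ : Euc d → Euc d) (_ : IsTestField U φ), ENNReal.ofReal (∫ x in E, vdiv φ x)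

section vdiv

variable {d : ℕ} {φ ψ : Euc d → Euc d}

lemma continuous_vdiv (hφ : ContDiff ℝ 1 φ) : Continuous (vdiv φ) := by
  unfold vdiv
  have h := hφ.continuous_fderiv one_ne_zero
  fun_prop

lemma vdiv_eq_zero_of_notMem_tsupport {x : Euc d} (hx : x ∉ tsupport φ) : vdiv φ x = 0 := by
  have : fderiv ℝ φ x = 0 := by
    by_contra h
    exact hx (support_fderiv_subset ℝ h)
  simp [vdiv, this]

lemma hasCompactSupport_vdiv (hφ : HasCompactSupport φ) : HasCompactSupport (vdiv φ) :=
  HasCompactSupport.intro hφ fun _ hx => vdiv_eq_zero_of_notMem_tsupport hx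

lemma integrable_vdiv (hφ : ContDiff ℝ 1 φ) (hc : HasCompactSupport φ) :
    Integrable (vdiv φ) :=
  (continuous_vdiv hφ).integrable_of_hasCompactSupport (hasCompactSupport_vdiv hc)

lemma vdiv_add (hφ : ContDiff ℝ 1 φ) (hψ : ContDiff ℝ 1 ψ) (x : Euc d) :
    vdiv (φ + ψ) x = vdiv φ x + vdiv ψ x := by
  unfold vdiv
  rw [fderiv_add (hφ.differentiable one_ne_zero x) (hψ.differentiable one_ne_zero x),
    ← Finset.sum_add_distrib]
  simp

lemma vdiv_smul {η : Euc d → ℝ} (hη : ContDiff ℝ 1 η) (hφ : ContDiff ℝ 1 φ) (x : Euc d) :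
    vdiv (fun y => η y • φ y) x = η x * vdiv φ x + fderiv ℝ η x (φ x) := by
  unfold vdiv
  have h : fderiv ℝ (fun y => η y • φ y) x =
      η x • fderiv ℝ φ x + (fderiv ℝ η x).smulRight (φ x) :=
    fderiv_fun_smul (hη.differentiable one_ne_zero x) (hφ.differentiable one_ne_zero x)
  have h2 : φ x = ∑ i, φ x i • EuclideanSpace.single i (1 : ℝ) := by
    ext j
    simp [Finset.sum_apply, Pi.single_apply]
  conv_rhs => rw [h2, map_sum]
  rw [h, Finset.mul_sum, ← Finset.sum_add_distrib]
  simp [mul_comm]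

end vdiv

section variation

variable {d : ℕ} {E U V W : Set (Euc d)} {φ : Euc d → Euc d}

lemma perim_eq_iInf_variation (E B : Set (Euc d)) :
    perim E B = ⨅ (U : Set (Euc d)) (_ : IsOpen U) (_ : B ⊆ U), variation E U := by
  unfold perim variation
  refine iInf_congr fun U => iInf_congr fun _ => iInf_congr fun _ => iSup_congr fun φ => ?_
  apply le_antisymm
  · exact iSup_le fun a => iSup_le fun b => iSup_le fun c => iSup_le fun e =>
      le_iSup_of_le (⟨a, b, c, e⟩ : IsTestField U φ) le_rfl
  · exact iSup_le fun h => le_iSup_of_le h.1 <| le_iSup_of_le h.2 <| le_iSup_of_le h.3 <|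
      le_iSup_of_le h.4 le_rfl

lemma perim_le_variation {B : Set (Euc d)} (hU : IsOpen U) (hB : B ⊆ U) :
    perim E B ≤ variation E U := by
  rw [perim_eq_iInf_variation]
  exact iInf_le_of_le U <| iInf_le_of_le hU <| iInf_le_of_le hB le_rfl

lemma IsTestField.mono (hφ : IsTestField U φ) (h : U ⊆ V) : IsTestField V φ :=
  ⟨hφ.1, hφ.2, hφ.3.trans h, hφ.4⟩

lemma IsTestField.ofReal_integral_le (hφ : IsTestField U φ) :
    ENNReal.ofReal (∫ x in E, vdiv φ x) ≤ variation E U :=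
  le_iSup₂_of_le φ hφ le_rfl

lemma IsTestField.integral_le (hφ : IsTestField U φ) (hV : variation E U ≠ ⊤) :
    ∫ x in E, vdiv φ x ≤ (variation E U).toReal :=
  (ENNReal.ofReal_le_iff_le_toReal hV).1 hφ.ofReal_integral_le

lemma isTestField_zero : IsTestField U (0 : Euc d → Euc d) :=
  ⟨contDiff_const, HasCompactSupport.zero, by simp [tsupport], by simp⟩

lemma variation_mono (h : U ⊆ V) : variation E U ≤ variation E V :=
  iSup₂_le fun _ hφ => (hφ.mono h).ofReal_integral_le

lemma variation_lt_top (hE : Caccioppoli E) (hU : Bornology.IsBounded U) :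
    variation E U < ⊤ := by
  obtain ⟨r, hr, hUr⟩ := hU.subset_ball_lt 0 0
  have h := hE.2 r hr
  rw [perim_eq_iInf_variation] at h
  simp only [iInf_lt_iff] at h
  obtain ⟨V, -, hV, h⟩ := h
  exact (variation_mono (hUr.trans hV)).trans_lt h

lemma IsTestField.add {ψ : Euc d → Euc d} (hφ : IsTestField U φ) (hψ : IsTestField V ψ)
    (hUV : Disjoint U V) (hU : U ⊆ W) (hV : V ⊆ W) : IsTestField W (φ + ψ) := by
  refine ⟨hφ.1.add hψ.1, hφ.2.add hψ.2, ?_, fun x => ?_⟩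
  · exact (tsupport_add φ ψ).trans (union_subset (hφ.3.trans hU) (hψ.3.trans hV))
  · by_cases hx : x ∈ U
    · have : ψ x = 0 := image_eq_zero_of_notMem_tsupport fun h =>
        disjoint_left.1 hUV hx (hψ.3 h)
      simpa [this] using hφ.4 x
    · have : φ x = 0 := image_eq_zero_of_notMem_tsupport fun h => hx (hφ.3 h)
      simpa [this] using hψ.4 x

lemma variation_add_le (hUV : Disjoint U V) (hU : U ⊆ W) (hV : V ⊆ W) :
    variation E U + variation E V ≤ variation E W := by
  refine ENNReal.biSup_add_biSup_le' ⟨0, isTestField_zero⟩ ⟨0, isTestField_zero⟩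
    fun φ hφ ψ hψ => ?_
  rcases le_total (∫ x in E, vdiv φ x) 0 with h | h
  · rw [ENNReal.ofReal_of_nonpos h, zero_add]
    exact (hψ.mono hV).ofReal_integral_le
  rcases le_total (∫ x in E, vdiv ψ x) 0 with h' | h'
  · rw [ENNReal.ofReal_of_nonpos h', add_zero]
    exact (hφ.mono hU).ofReal_integral_le
  rw [← ENNReal.ofReal_add h h', ← integral_add (integrable_vdiv hφ.1 hφ.2).integrableOn
    (integrable_vdiv hψ.1 hψ.2).integrableOn]
  simp_rw [← vdiv_add hφ.1 hψ.1]
  exact (hφ.add hψ hUV hU hV).ofReal_integral_le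

end variation

/-- A `C¹` approximation of the Heaviside step at `ρ`, with derivative `w` supported in
`(ρ - b, ρ + b)` and bounded by `1 / (2 a)`, where `a < b` may be arbitrarily close to `b`. -/
lemma exists_step (ρ : ℝ) {a b : ℝ} (ha : 0 < a) (hab : a < b) :
    ∃ θ w : ℝ → ℝ, ContDiff ℝ 1 θ ∧ (∀ t, HasDerivAt θ (w t) t) ∧ (∀ t, 0 ≤ w t) ∧
      (∀ t, w t ≤ 1 / (2 * a)) ∧ (∀ t, b ≤ |t - ρ| → w t = 0) ∧
      (∀ t ≤ ρ - b, θ t = 0) ∧ (∀ t, ρ + b ≤ t → θ t = 1) ∧ ∀ t, θ t ∈ Icc 0 1 := by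
  let f : ContDiffBump ρ := ⟨a, b, ha, hab⟩
  let w : ℝ → ℝ := f.normed volume
  have hw : Continuous w := f.continuous_normed
  have hw0 : ∀ t, 0 ≤ w t := fun t => f.nonneg_normed t
  have hws : ∀ t, b ≤ |t - ρ| → w t = 0 := fun t ht => by
    have : t ∉ Function.support w := by
      rw [f.support_normed_eq]
      simpa [Real.dist_eq] using ht
    simpa using this
  let θ : ℝ → ℝ := fun t => ∫ s in (ρ - b)..t, w s
  have hd : ∀ t, HasDerivAt θ (w t) t := fun t =>
    intervalIntegral.integral_hasDerivAt_right (hw.intervalIntegrable _ _)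
      hw.stronglyMeasurable.stronglyMeasurableAtFilter hw.continuousAt
  have hmono : Monotone θ := monotone_of_deriv_nonneg (fun t => (hd t).differentiableAt)
    fun t => by rw [(hd t).deriv]; exact hw0 t
  have h0 : ∀ t ≤ ρ - b, θ t = 0 := fun t ht => by
    have : ∫ s in (ρ - b)..t, w s = ∫ s in (ρ - b)..t, (0 : ℝ) :=
      intervalIntegral.integral_congr fun s hs => by
        rw [uIcc_of_ge ht] at hs
        exact hws s (by rw [abs_of_nonpos] <;> linarith [hs.2])
    simpa [θ] using this
  have h1 : ∀ t, ρ + b ≤ t → θ t = 1 := fun t ht => by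
    rw [← f.integral_normed (μ := volume)]
    change ∫ s in (ρ - b)..t, w s = ∫ s, w s
    rw [intervalIntegral.integral_of_le (by linarith)]
    refine setIntegral_eq_integral_of_forall_compl_eq_zero fun s hs => hws s ?_
    rw [mem_Ioc, not_and_or, not_lt, not_le] at hs
    rcases hs with hs | hs
    · rw [abs_of_nonpos] <;> linarith
    · rw [abs_of_nonneg] <;> linarith
  refine ⟨θ, w, ?_, hd, hw0, fun t => ?_, hws, h0, h1, fun t => ⟨?_, ?_⟩⟩
  · rw [contDiff_one_iff_deriv]
    exact ⟨fun t => (hd t).differentiableAt, by simpa [funext fun t => (hd t).deriv] using hw⟩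
  · refine (f.normed_le_div_measure_closedBall_rIn volume t).trans_eq ?_
    rw [measureReal_def, Real.volume_closedBall, ENNReal.toReal_ofReal (by positivity)]
  · rw [← h0 (min t (ρ - b)) (min_le_right _ _)]
    exact hmono (min_le_left _ _)
  · rw [← h1 (max t (ρ + b)) (le_max_right _ _)]
    exact hmono (le_max_left _ _)

/-- A `C¹` radial cutoff rising from `0` to `1` across the shell of half-width `b` around the
sphere of radius `ρ`, with slope at most `1 / (2 a)`. -/
lemma exists_radial_cutoff {d : ℕ} (c : Euc d) {ρ a b : ℝ} (ha : 0 < a) (hab : a < b)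
    (hb : b < ρ) :
    ∃ η : Euc d → ℝ, ContDiff ℝ 1 η ∧ (∀ x, η x ∈ Icc 0 1) ∧
      (∀ x, dist x c ≤ ρ - b → η x = 0) ∧ (∀ x, ρ + b ≤ dist x c → η x = 1) ∧
      ∀ x v, |fderiv ℝ η x v| ≤
        (ball c (ρ + b) \ ball c (ρ - b)).indicator (fun _ => 1 / (2 * a)) x * ‖v‖ := by
  obtain ⟨θ, w, hθ, hd, hw0, hwa, hws, h0, h1, h01⟩ := exists_step ρ ha hab
  have hc : (fun x : Euc d => θ ‖x - c‖) =ᶠ[𝓝 c] fun _ => 0 := by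
    filter_upwards [ball_mem_nhds c (sub_pos.2 hb)] with x hx
    exact h0 _ (by rw [← dist_eq_norm]; exact (mem_ball.1 hx).le)
  refine ⟨fun x => θ ‖x - c‖, ?_, fun x => h01 _, fun x hx => h0 _ (by rwa [← dist_eq_norm]),
    fun x hx => h1 _ (by rwa [← dist_eq_norm]), fun x v => ?_⟩
  · rw [contDiff_iff_contDiffAt]
    intro x
    rcases eq_or_ne x c with rfl | hx
    · exact contDiffAt_const.congr_of_eventuallyEq hc
    · exact hθ.contDiffAt.comp x
        ((contDiffAt_id.sub contDiffAt_const).norm ℝ (sub_ne_zero.2 hx))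
  · have key : |fderiv ℝ (fun x : Euc d => θ ‖x - c‖) x v| ≤ w ‖x - c‖ * ‖v‖ := by
      rcases eq_or_ne x c with rfl | hx
      · rw [hc.fderiv_eq]
        simpa using mul_nonneg (hw0 0) (norm_nonneg v)
      · have hn : DifferentiableAt ℝ (fun y : Euc d => ‖y - c‖) x :=
          (differentiableAt_id.sub_const c).norm ℝ (sub_ne_zero.2 hx)
        have hl : ‖fderiv ℝ (fun y : Euc d => ‖y - c‖) x‖ ≤ (1 : NNReal) :=
          norm_fderiv_le_of_lipschitz ℝ <| LipschitzWith.of_dist_le_mul fun y z => by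
            rw [NNReal.coe_one, one_mul, Real.dist_eq]
            simpa [dist_eq_norm] using abs_norm_sub_norm_le (y - c) (z - c)
        have hfd : HasFDerivAt (fun y => θ ‖y - c‖)
            (w ‖x - c‖ • fderiv ℝ (fun y => ‖y - c‖) x) x :=
          (hd ‖x - c‖).comp_hasFDerivAt x hn.hasFDerivAt
        rw [hfd.fderiv, smul_apply, smul_eq_mul, abs_mul, abs_of_nonneg (hw0 _)]
        refine mul_le_mul_of_nonneg_left ?_ (hw0 _)
        simpa using ContinuousLinearMap.le_of_opNorm_le _ hl v
    refine key.trans (mul_le_mul_of_nonneg_right ?_ (norm_nonneg v))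
    by_cases hx : x ∈ ball c (ρ + b) \ ball c (ρ - b)
    · rw [indicator_of_mem hx]
      exact hwa _
    · rw [indicator_of_notMem hx, hws]
      simp only [Set.mem_sdiff, mem_ball, not_and, not_not, dist_eq_norm] at hx
      by_cases h : ‖x - c‖ < ρ + b
      · exact (le_abs_self _).trans' (by linarith [hx h]) |>.trans_eq (abs_sub_comm _ _)
      · exact (le_abs_self _).trans' (by linarith)

/-- The volume of `(E ∆ F) ∩ B` inside the ball of radius `t` around `c`. -/
def symmDiffVol {d : ℕ} (E F B : Set (Euc d)) (c : Euc d) (t : ℝ) : ℝ :=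
  volume.real ((E ∆ F) ∩ ball c t ∩ B)

section symmDiffVol

variable {d : ℕ} {E F B : Set (Euc d)} {c : Euc d}

lemma volume_inter_ball_inter_ne_top (S : Set (Euc d)) (t : ℝ) :
    volume (S ∩ ball c t ∩ B) ≠ ⊤ :=
  ((measure_mono (inter_subset_left.trans inter_subset_right)).trans_lt
    measure_ball_lt_top).ne

lemma monotone_symmDiffVol : Monotone (symmDiffVol E F B c) := fun s t h =>
  measureReal_mono (by gcongr) (volume_inter_ball_inter_ne_top _ _)

lemma volume_real_symmDiff_shell (hB : MeasurableSet B) (hE : MeasurableSet E)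
    (hF : MeasurableSet F) {s t : ℝ} (h : s ≤ t) :
    volume.real ((E ∆ F) ∩ (ball c t \ ball c s) ∩ B) =
      symmDiffVol E F B c t - symmDiffVol E F B c s := by
  have hsub : (E ∆ F) ∩ ball c s ∩ B ⊆ (E ∆ F) ∩ ball c t ∩ B := by gcongr
  unfold symmDiffVol
  rw [← measureReal_sdiff hsub (((hE.symmDiff hF).inter measurableSet_ball).inter hB)
    (volume_inter_ball_inter_ne_top _ _)]
  congr 1
  ext x
  simp only [mem_inter_iff, Set.mem_sdiff]
  tauto

end symmDiffVol

section cut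

variable {d : ℕ} {E F B U : Set (Euc d)} {c : Euc d} {ρ : ℝ} {φ : Euc d → Euc d}

lemma IsTestField.smul {η : Euc d → ℝ} (hφ : IsTestField U φ) (hη : ContDiff ℝ 1 η)
    (h01 : ∀ x, η x ∈ Icc 0 1) : IsTestField U (fun x => η x • φ x) := by
  refine ⟨hη.smul hφ.1, HasCompactSupport.smul_left (f := η) hφ.2,
    (tsupport_smul_subset_right η φ).trans hφ.3, fun x => ?_⟩
  rw [norm_smul, Real.norm_of_nonneg (h01 x).1]
  exact mul_le_one₀ (h01 x).2 (norm_nonneg _) (hφ.4 x)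

lemma IsTestField.exists_cutoff_integral_le (hφ : IsTestField U φ) (hE : MeasurableSet E)
    (hF : MeasurableSet F) (hB : MeasurableSet B) (hUB : U ⊆ B) (hVE : variation E U ≠ ⊤)
    (hVF : variation F U ≠ ⊤) {a b : ℝ} (ha : 0 < a) (hab : a < b) (hb : b < ρ) :
    ∃ η : Euc d → ℝ, Continuous η ∧ (∀ x, η x ∈ Icc 0 1) ∧
      (∀ x, dist x c ≤ ρ - b → η x = 0) ∧ (∀ x, ρ + b ≤ dist x c → η x = 1) ∧
      (∫ x in E, η x * vdiv φ x) + ∫ x in F, (1 - η x) * vdiv φ x ≤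
        (variation E U).toReal + (variation F U).toReal +
          (symmDiffVol E F B c (ρ + b) - symmDiffVol E F B c (ρ - b)) / (2 * a) := by
  obtain ⟨η, hη, h01, h0, h1, hη'⟩ := exists_radial_cutoff c ha hab hb
  refine ⟨η, hη.continuous, h01, h0, h1, ?_⟩
  have hη1 : ContDiff ℝ 1 (fun x => 1 - η x) := contDiff_const.sub hη
  have h01' : ∀ x, 1 - η x ∈ Icc (0 : ℝ) 1 := fun x =>
    ⟨by linarith [(h01 x).2], by linarith [(h01 x).1]⟩
  have t1 := hφ.smul hη h01
  have t2 := hφ.smul hη1 h01'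
  have i1 := integrable_vdiv t1.1 t1.2
  have i2 := integrable_vdiv t2.1 t2.2
  let p : Euc d → ℝ := fun x => fderiv ℝ η x (φ x)
  have e1 : ∀ x, η x * vdiv φ x = vdiv (fun y => η y • φ y) x - p x := fun x => by
    rw [vdiv_smul hη hφ.1]; simp [p]
  have e2 : ∀ x, (1 - η x) * vdiv φ x = vdiv (fun y => (1 - η y) • φ y) x + p x := fun x => by
    rw [vdiv_smul hη1 hφ.1, fderiv_const_sub]; simp [p]
  have ip : Integrable p := by
    refine Continuous.integrable_of_hasCompactSupport ?_ ?_
    · have := hη.continuous_fderiv one_ne_zero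
      have := hφ.1.continuous
      fun_prop
    · exact hφ.2.mono' fun x hx => subset_tsupport _ fun h => hx (by simp [p, h])
  simp_rw [e1, e2]
  rw [integral_sub i1.integrableOn ip.integrableOn, integral_add i2.integrableOn ip.integrableOn]
  have b1 := t1.integral_le hVE
  have b2 := t2.integral_le hVF
  let S : Set (Euc d) := (E ∆ F) ∩ (ball c (ρ + b) \ ball c (ρ - b)) ∩ B
  have hS : MeasurableSet S :=
    ((hE.symmDiff hF).inter (measurableSet_ball.diff measurableSet_ball)).inter hB
  have hSfin : volume S ≠ ⊤ := ((measure_mono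
    ((inter_subset_left.trans inter_subset_right).trans sdiff_subset)).trans_lt
      (measure_ball_lt_top (x := c) (r := ρ + b))).ne
  have b3 : (∫ x in F, p x) - ∫ x in E, p x ≤
      (symmDiffVol E F B c (ρ + b) - symmDiffVol E F B c (ρ - b)) / (2 * a) := by
    rw [← volume_real_symmDiff_shell hB hE hF (by linarith), ← integral_indicator hF,
      ← integral_indicator hE, ← integral_sub (ip.indicator hF) (ip.indicator hE)]
    calc ∫ x, F.indicator p x - E.indicator p x
        ≤ ∫ x, S.indicator (fun _ => 1 / (2 * a)) x := by
          refine integral_mono ((ip.indicator hF).sub (ip.indicator hE))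
            ((integrable_indicator_iff hS).2 (integrableOn_const hSfin)) fun x => ?_
          have hp : |p x| ≤
              ((ball c (ρ + b) \ ball c (ρ - b)) ∩ B).indicator (fun _ => 1 / (2 * a)) x := by
            by_cases hx : x ∈ B
            · refine (hη' x (φ x)).trans ?_
              have hi : 0 ≤ (ball c (ρ + b) \ ball c (ρ - b)).indicator
                (fun _ => 1 / (2 * a)) x := indicator_nonneg (fun _ _ => by positivity) x
              refine (mul_le_of_le_one_right hi (hφ.4 x)).trans_eq ?_
              simp [indicator, hx]
            · have : φ x = 0 := image_eq_zero_of_notMem_tsupport fun h => hx (hUB (hφ.3 h))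
              simp [p, this, hx]
          have hp1 := le_abs_self (p x)
          have hp2 := neg_abs_le (p x)
          have hS_iff : x ∈ S ↔ (x ∈ E ∧ x ∉ F ∨ x ∈ F ∧ x ∉ E) ∧
              x ∈ (ball c (ρ + b) \ ball c (ρ - b)) ∩ B := by
            simp only [S, mem_inter_iff, mem_symmDiff, and_assoc]
          generalize (ball c (ρ + b) \ ball c (ρ - b)) ∩ B = D at hp hS_iff
          clear_value S p
          classical
          simp only [indicator_apply] at hp ⊢
          split_ifs at hp ⊢ <;> first | linarith | (exfalso; tauto)
      _ = volume.real S / (2 * a) := by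
          rw [integral_indicator hS, setIntegral_const, smul_eq_mul]; ring
  linarith

lemma tendsto_symm_slope {g : ℝ → ℝ} (hg : DifferentiableAt ℝ g ρ) {a b : ℕ → ℝ}
    (hb0 : ∀ m, 0 < b m) (hb : Tendsto b atTop (𝓝 0)) (ha : ∀ m, 0 < a m)
    (hab : Tendsto (fun m => b m / a m) atTop (𝓝 1)) :
    Tendsto (fun m => (g (ρ + b m) - g (ρ - b m)) / (2 * a m)) atTop (𝓝 (deriv g ρ)) := by
  have h := hasDerivAt_iff_tendsto_slope_zero.1 hg.hasDerivAt
  have h1 : Tendsto b atTop (𝓝[≠] 0) := tendsto_nhdsWithin_iff.2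
    ⟨hb, Eventually.of_forall fun m => (hb0 m).ne'⟩
  have h2 : Tendsto (fun m => -b m) atTop (𝓝[≠] 0) := tendsto_nhdsWithin_iff.2
    ⟨by simpa using hb.neg, Eventually.of_forall fun m => (neg_ne_zero.2 (hb0 m).ne')⟩
  have := (((h.comp h1).add (h.comp h2)).div_const 2).mul hab
  simp only [Function.comp_def, smul_eq_mul] at this
  convert this using 2 with m
  · have := (hb0 m).ne'
    have := (ha m).ne'
    rw [← sub_eq_add_neg]
    field_simp
    ring
  · ring

/-- The set agreeing with `F` inside the ball of radius `ρ` around `c`, and with `E` outside. -/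
def cutSet (E F : Set (Euc d)) (c : Euc d) (ρ : ℝ) : Set (Euc d) :=
  (E \ ball c ρ) ∪ (F ∩ ball c ρ)

lemma variation_cutSet_le (hE : MeasurableSet E) (hF : MeasurableSet F) (hB : MeasurableSet B)
    (hUB : U ⊆ B) (hVE : variation E U ≠ ⊤) (hVF : variation F U ≠ ⊤) (hρ : 0 < ρ)
    (hg : DifferentiableAt ℝ (symmDiffVol E F B c) ρ) :
    variation (cutSet E F c ρ) U ≤ variation E U + variation F U +
      ENNReal.ofReal (deriv (symmDiffVol E F B c) ρ) := by
  refine iSup₂_le fun φ hφ => ?_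
  have hg0 : 0 ≤ deriv (symmDiffVol E F B c) ρ := monotone_symmDiffVol.deriv_nonneg
  rw [← ENNReal.ofReal_toReal hVE, ← ENNReal.ofReal_toReal hVF,
    ← ENNReal.ofReal_add ENNReal.toReal_nonneg ENNReal.toReal_nonneg,
    ← ENNReal.ofReal_add (by positivity) hg0]
  refine ENNReal.ofReal_le_ofReal ?_
  have iφ := integrable_vdiv hφ.1 hφ.2
  let b : ℕ → ℝ := fun m => ρ / (m + 2)
  let a : ℕ → ℝ := fun m => b m * ((m + 1) / (m + 2))
  have hb0 : ∀ m, 0 < b m := fun m => by positivity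
  have ha0 : ∀ m, 0 < a m := fun m => by positivity
  have hab : ∀ m, a m < b m := fun m => by
    refine mul_lt_of_lt_one_right (hb0 m) ?_
    rw [div_lt_one (by positivity)]
    linarith
  have hbρ : ∀ m, b m < ρ := fun m => by
    rw [div_lt_iff₀ (by positivity)]
    nlinarith [(Nat.cast_nonneg m : (0 : ℝ) ≤ m)]
  have hbt : Tendsto b atTop (𝓝 0) := Tendsto.const_div_atTop
    (tendsto_atTop_add_const_right _ _ tendsto_natCast_atTop_atTop) ρ
  have habt : Tendsto (fun m => b m / a m) atTop (𝓝 1) := by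
    have h : Tendsto (fun m : ℕ => 1 + 1 / ((m : ℝ) + 1)) atTop (𝓝 (1 + 0)) :=
      tendsto_one_div_add_atTop_nhds_zero_nat.const_add 1
    rw [add_zero] at h
    refine h.congr fun m => ?_
    have := (hb0 m).ne'
    simp only [a]
    field_simp
    ring
  choose η hηc h01 h0 h1 hle using fun m =>
    hφ.exists_cutoff_integral_le (c := c) hE hF hB hUB hVE hVF (ha0 m) (hab m) (hbρ m)
  have hsphere : ∀ᵐ x : Euc d, dist x c ≠ ρ := by
    rw [ae_iff]
    simp only [not_not]
    exact Measure.addHaar_sphere_of_ne_zero volume c hρ.ne'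
  have hlim : ∀ᵐ x : Euc d, Tendsto (fun m => η m x) atTop
      (𝓝 ((ball c ρ)ᶜ.indicator (fun _ => 1) x)) := by
    filter_upwards [hsphere] with x hx
    refine tendsto_const_nhds.congr' ?_
    have : ∀ᶠ m in atTop, b m < |dist x c - ρ| :=
      hbt.eventually_lt_const (abs_pos.2 (sub_ne_zero.2 hx))
    filter_upwards [this] with m hm
    rcases lt_or_gt_of_ne hx with h | h
    · rw [abs_of_neg (sub_neg.2 h)] at hm
      rw [h0 m x (by linarith), indicator_of_notMem]
      simpa using h
    · rw [abs_of_pos (sub_pos.2 h)] at hm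
      rw [h1 m x (by linarith), indicator_of_mem]
      simpa using h.le
  have hbound : ∀ m, ∀ x, ‖η m x * vdiv φ x‖ ≤ ‖vdiv φ x‖ := fun m x => by
    rw [norm_mul, Real.norm_of_nonneg (h01 m x).1]
    exact mul_le_of_le_one_left (norm_nonneg _) (h01 m x).2
  have hbound' : ∀ m, ∀ x, ‖(1 - η m x) * vdiv φ x‖ ≤ ‖vdiv φ x‖ := fun m x => by
    rw [norm_mul, Real.norm_of_nonneg (by linarith [(h01 m x).2])]
    exact mul_le_of_le_one_left (norm_nonneg _) (by linarith [(h01 m x).1])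
  have cφ := continuous_vdiv hφ.1
  have l1 : Tendsto (fun m => ∫ x in E, η m x * vdiv φ x) atTop
      (𝓝 (∫ x in E, (ball c ρ)ᶜ.indicator (vdiv φ) x)) := by
    refine tendsto_integral_of_dominated_convergence (fun x => ‖vdiv φ x‖)
      (fun m => ((hηc m).mul cφ).aestronglyMeasurable) iφ.norm.integrableOn
      (fun m => Eventually.of_forall (hbound m)) ?_
    filter_upwards [ae_restrict_of_ae hlim] with x hx
    have := hx.mul_const (vdiv φ x)
    convert this using 2
    by_cases h : x ∈ ball c ρ <;> simp [indicator, h]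
  have l2 : Tendsto (fun m => ∫ x in F, (1 - η m x) * vdiv φ x) atTop
      (𝓝 (∫ x in F, (ball c ρ).indicator (vdiv φ) x)) := by
    refine tendsto_integral_of_dominated_convergence (fun x => ‖vdiv φ x‖)
      (fun m => ((continuous_const.sub (hηc m)).mul cφ).aestronglyMeasurable)
      iφ.norm.integrableOn (fun m => Eventually.of_forall (hbound' m)) ?_
    filter_upwards [ae_restrict_of_ae hlim] with x hx
    have := (hx.const_sub 1).mul_const (vdiv φ x)
    convert this using 2
    by_cases h : x ∈ ball c ρ <;> simp [indicator, h]
  have hsplit : ∫ x in cutSet E F c ρ, vdiv φ x =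
      (∫ x in E, (ball c ρ)ᶜ.indicator (vdiv φ) x) +
        ∫ x in F, (ball c ρ).indicator (vdiv φ) x := by
    rw [setIntegral_indicator measurableSet_ball.compl, setIntegral_indicator measurableSet_ball,
      ← Set.sdiff_eq]
    exact setIntegral_union (disjoint_left.2 fun x h h' => h.2 h'.2)
      (hF.inter measurableSet_ball) iφ.integrableOn iφ.integrableOn
  rw [hsplit]
  exact le_of_tendsto_of_tendsto' (l1.add l2)
    ((tendsto_symm_slope hg hb0 hbt ha0 habt).const_add _) hle

end cut

section sphere

variable {d : ℕ} {E E' F G B U : Set (Euc d)} {c : Euc d} {ρ R : ℝ}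

lemma variation_congr (hE : MeasurableSet E) (hE' : MeasurableSet E')
    (h : ∀ x ∈ U, x ∈ E ↔ x ∈ E') : variation E U = variation E' U := by
  refine iSup_congr fun φ => iSup_congr fun hφ => ?_
  rw [← integral_indicator hE, ← integral_indicator hE']
  congr 2
  ext x
  by_cases hx : x ∈ U
  · by_cases hxE : x ∈ E
    · simp [hxE, (h x hx).1 hxE]
    · simp [hxE, mt (h x hx).2 hxE]
  · have : vdiv φ x = 0 := vdiv_eq_zero_of_notMem_tsupport fun h' => hx (hφ.3 h')
    simp [indicator, this]

lemma monotone_variation_ball_inter :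
    Monotone fun t => variation E (ball c t ∩ B) := fun _ _ h =>
  variation_mono (by gcongr)

lemma tendsto_variation_shell (hE : Caccioppoli E)
    (hcont : ContinuousAt (fun t => variation E (ball c t ∩ B)) ρ) :
    Tendsto (fun δ => variation E ((ball c (ρ + δ) \ closedBall c (ρ - δ)) ∩ B))
      (𝓝[>] 0) (𝓝 0) := by
  have hfin : ∀ t, variation E (ball c t ∩ B) ≠ ⊤ := fun t =>
    (variation_lt_top hE (isBounded_ball.subset inter_subset_left)).ne
  have h1 : Tendsto (fun δ : ℝ => ρ + δ) (𝓝[>] 0) (𝓝 ρ) :=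
    ((continuous_const.add continuous_id).tendsto' _ _ (by simp)).mono_left nhdsWithin_le_nhds
  have h2 : Tendsto (fun δ : ℝ => ρ - δ) (𝓝[>] 0) (𝓝 ρ) :=
    ((continuous_const.sub continuous_id).tendsto' _ _ (by simp)).mono_left nhdsWithin_le_nhds
  have h := ENNReal.Tendsto.sub (hcont.tendsto.comp h1) (hcont.tendsto.comp h2)
    (Or.inl (hfin ρ))
  rw [tsub_self] at h
  refine tendsto_of_tendsto_of_tendsto_of_le_of_le' tendsto_const_nhds h
    (Eventually.of_forall fun _ => zero_le) ?_
  filter_upwards [self_mem_nhdsWithin] with δ hδ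
  have hδ : 0 < δ := hδ
  refine ENNReal.le_sub_of_add_le_right (hfin _) (variation_add_le ?_ ?_ ?_)
  · exact disjoint_left.2 fun x hx hx' => hx.1.2 (ball_subset_closedBall hx'.1)
  · exact inter_subset_inter_left _ sdiff_subset
  · exact inter_subset_inter_left _ (ball_subset_ball (by linarith))

lemma perim_sphere_le (hE : Caccioppoli E) (hF : Caccioppoli F) (hG : MeasurableSet G)
    (hB : IsOpen B) (hρ : 0 < ρ) (hρR : ρ < R)
    (hGEF : ∀ x ∈ ball c R ∩ B, x ∈ G ↔ x ∈ cutSet E F c ρ)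
    (hcE : ContinuousAt (fun t => variation E (ball c t ∩ B)) ρ)
    (hcF : ContinuousAt (fun t => variation F (ball c t ∩ B)) ρ)
    (hg : DifferentiableAt ℝ (symmDiffVol E F B c) ρ) :
    perim G (sphere c ρ ∩ B) ≤ ENNReal.ofReal (deriv (symmDiffVol E F B c) ρ) := by
  have hlim := ((tendsto_variation_shell hE hcE).add (tendsto_variation_shell hF hcF)).add_const
    (ENNReal.ofReal (deriv (symmDiffVol E F B c) ρ))
  rw [add_zero, zero_add] at hlim
  refine ge_of_tendsto hlim ?_
  filter_upwards [Ioo_mem_nhdsGT (sub_pos.2 hρR)] with δ hδ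
  set U := (ball c (ρ + δ) \ closedBall c (ρ - δ)) ∩ B
  have hUo : IsOpen U := (isOpen_ball.sdiff isClosed_closedBall).inter hB
  have hUb : Bornology.IsBounded U := isBounded_ball.subset (inter_subset_left.trans sdiff_subset)
  have hsub : sphere c ρ ∩ B ⊆ U := by
    rintro x ⟨hx, hxB⟩
    rw [mem_sphere] at hx
    refine ⟨⟨?_, ?_⟩, hxB⟩
    · rw [mem_ball]; linarith [hδ.1]
    · rw [mem_closedBall]; linarith [hδ.1]
  have hcut : MeasurableSet (cutSet E F c ρ) :=
    (hE.1.diff measurableSet_ball).union (hF.1.inter measurableSet_ball)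
  calc perim G (sphere c ρ ∩ B) ≤ variation G U := perim_le_variation hUo hsub
    _ = variation (cutSet E F c ρ) U := variation_congr hG hcut fun x hx =>
        hGEF x ⟨ball_subset_ball (by linarith [hδ.2]) hx.1.1, hx.2⟩
    _ ≤ _ := variation_cutSet_le hE.1 hF.1 hB.measurableSet inter_subset_right
        (variation_lt_top hE hUb).ne (variation_lt_top hF hUb).ne hρ hg

lemma ae_continuousAt_variation_ball_inter (E B : Set (Euc d)) (c : Euc d) :
    ∀ᵐ t : ℝ, ContinuousAt (fun t => variation E (ball c t ∩ B)) t := by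
  filter_upwards [(monotone_variation_ball_inter (E := E) (B := B)
    (c := c)).countable_not_continuousAt.ae_notMem volume] with t ht
  simpa using ht

end sphere

/-- If the `f i` are monotone, then the sum of their derivatives is at most the average slope of
their sum on a subset of `(r, R)` of positive measure. -/
lemma volume_sum_deriv_le_pos {ι : Type*} (s : Finset ι) {f : ι → ℝ → ℝ}
    (hf : ∀ i, Monotone (f i)) {r R : ℝ} (hrR : r < R) :
    0 < volume {t ∈ Ioo r R |
      ∑ i ∈ s, deriv (f i) t ≤ (∑ i ∈ s, (f i R - f i r)) / (R - r)} := by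
  have hint : ∀ i, IntegrableOn (deriv (f i)) (Ioo r R) := fun i => by
    have h : IntervalIntegrable (deriv (f i)) volume r R :=
      ((hf i).monotoneOn _).intervalIntegrable_deriv
    rw [intervalIntegrable_iff_integrableOn_Ioo_of_le hrR.le] at h
    exact h
  have hvol : volume (Ioo r R) ≠ 0 := by simpa using hrR
  have hpos := measure_le_setAverage_pos (μ := volume) (f := fun t => ∑ i ∈ s, deriv (f i) t)
    hvol (by simp) (integrable_finsetSum s fun i _ => hint i)
  refine hpos.trans_le (measure_mono fun t ht => ⟨ht.1, ht.2.trans ?_⟩)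
  rw [setAverage_eq, integral_finsetSum s fun i _ => hint i, smul_eq_mul, measureReal_def,
    Real.volume_Ioo, ENNReal.toReal_ofReal (sub_pos.2 hrR).le, div_eq_inv_mul]
  refine mul_le_mul_of_nonneg_left (Finset.sum_le_sum fun i _ => ?_)
    (inv_nonneg.2 (sub_pos.2 hrR).le)
  have h := ((hf i).monotoneOn (uIcc r R)).intervalIntegral_deriv_mem_uIcc
  rw [uIcc_of_le (sub_nonneg.2 (hf i hrR.le)), intervalIntegral.integral_of_le hrR.le,
    integral_Ioc_eq_integral_Ioo] at h
  exact h.2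

/-- **Glueing lemma.** -/
theorem glueing_lemma {d N n : ℕ}
    (E : Fin N → Set (Euc d)) (hE : IsPartition E) (hEc : ∀ k, Caccioppoli (E k))
    (F : Fin n → Fin N → Set (Euc d)) (hF : ∀ i, IsPartition (F i))
    (hFc : ∀ i k, Caccioppoli (F i k))
    (R : ℝ) (hR : 0 < R) (x : Fin n → Euc d)
    (hdisj : ∀ i i', i ≠ i' → Disjoint (ball (x i) R) (ball (x i') R))
    (B : Set (Euc d)) (hB : (∃ c ρ, 0 < ρ ∧ B = ball c ρ) ∨ B = univ)
    (G : ℝ → Fin N → Set (Euc d))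
    (hG : ∀ ρ k, G ρ k =
      (E k \ ⋃ i, (ball (x i) ρ ∩ B)) ∪ ⋃ i, (F i k ∩ ball (x i) ρ ∩ B))
    (r : ℝ) (hr : 0 < r) (hrR : r < R) :
    0 < volume {ρ : ℝ | ρ ∈ Ioo r R ∧
      ∑ i, partPerim (G ρ) (sphere (x i) ρ ∩ B) ≤
        (∑ i, ∑ k, volume ((E k ∆ (F i k)) ∩ (ball (x i) R \ ball (x i) r) ∩ B)) /
          ENNReal.ofReal (2 * (R - r))} := by
  have hBo : IsOpen B := by
    rcases hB with ⟨c, ρ, -, rfl⟩ | rfl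
    exacts [isOpen_ball, isOpen_univ]
  let g : Fin n × Fin N → ℝ → ℝ := fun q => symmDiffVol (E q.2) (F q.1 q.2) B (x q.1)
  have hgmono : ∀ q, Monotone (g q) := fun q => monotone_symmDiffVol
  have hpos := volume_sum_deriv_le_pos Finset.univ hgmono hrR
  have hae : ∀ᵐ ρ : ℝ, ∀ i k,
      ContinuousAt (fun t => variation (E k) (ball (x i) t ∩ B)) ρ ∧
      ContinuousAt (fun t => variation (F i k) (ball (x i) t ∩ B)) ρ ∧
      DifferentiableAt ℝ (g (i, k)) ρ := by
    simp only [ae_all_iff]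
    intro i k
    filter_upwards [ae_continuousAt_variation_ball_inter (E k) B (x i),
      ae_continuousAt_variation_ball_inter (F i k) B (x i),
      (hgmono (i, k)).ae_differentiableAt] with ρ h1 h2 h3 using ⟨h1, h2, h3⟩
  refine hpos.trans_le (measure_mono_ae ?_)
  filter_upwards [hae] with ρ hρ hmem
  obtain ⟨hρI, hle⟩ := hmem
  refine ⟨hρI, ?_⟩
  have hρ0 : 0 < ρ := hr.trans hρI.1
  have hGm : ∀ k, MeasurableSet (G ρ k) := fun k => by
    rw [hG]
    exact ((hE.meas k).diff (MeasurableSet.iUnion fun i =>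
      measurableSet_ball.inter hBo.measurableSet)).union (MeasurableSet.iUnion fun i =>
        (((hF i).meas k).inter measurableSet_ball).inter hBo.measurableSet)
  have hper : ∀ i k, perim (G ρ k) (sphere (x i) ρ ∩ B) ≤
      ENNReal.ofReal (deriv (g (i, k)) ρ) := fun i k => by
    refine perim_sphere_le (R := R) (hEc k) (hFc i k) (hGm k) hBo hρ0 hρI.2 ?_
      (hρ i k).1 (hρ i k).2.1 (hρ i k).2.2
    rintro y ⟨hyR, hyB⟩
    have hother : ∀ j, y ∈ ball (x j) ρ → j = i := fun j hj => by
      by_contra hne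
      exact disjoint_left.1 (hdisj j i hne) (ball_subset_ball hρI.2.le hj) hyR
    rw [hG]
    simp only [cutSet, mem_union, Set.mem_sdiff, mem_iUnion, mem_inter_iff, hyB, and_true]
    refine or_congr (and_congr_right fun _ => not_congr ?_) ?_
    · exact ⟨fun ⟨j, hj⟩ => hother j hj ▸ hj, fun h => ⟨i, h⟩⟩
    · exact ⟨fun ⟨j, hj⟩ => hother j hj.2 ▸ hj, fun h => ⟨i, h⟩⟩
  have hvol : ∀ i k, volume ((E k ∆ (F i k)) ∩ (ball (x i) R \ ball (x i) r) ∩ B) =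
      ENNReal.ofReal (g (i, k) R - g (i, k) r) := fun i k => by
    have hfin : volume ((E k ∆ (F i k)) ∩ (ball (x i) R \ ball (x i) r) ∩ B) ≠ ⊤ :=
      ((measure_mono ((inter_subset_left.trans inter_subset_right).trans
        sdiff_subset)).trans_lt (measure_ball_lt_top (x := x i) (r := R))).ne
    rw [← volume_real_symmDiff_shell hBo.measurableSet (hE.meas k) ((hF i).meas k) hrR.le,
      measureReal_def, ENNReal.ofReal_toReal hfin]
  have hg0 : ∀ q, 0 ≤ deriv (g q) ρ := fun q => (hgmono q).deriv_nonneg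
  have hgR : ∀ q, 0 ≤ g q R - g q r := fun q => sub_nonneg.2 (hgmono q hrR.le)
  have hRr : 0 < R - r := sub_pos.2 hrR
  calc ∑ i, partPerim (G ρ) (sphere (x i) ρ ∩ B)
      ≤ ∑ i, (∑ k, ENNReal.ofReal (deriv (g (i, k)) ρ)) / 2 := by
        unfold partPerim
        gcongr
        exact hper _ _
    _ = ENNReal.ofReal ((∑ q, deriv (g q) ρ) / 2) := by
        simp_rw [div_eq_mul_inv]
        rw [← Finset.sum_mul, ← Fintype.sum_prod_type',
          ← ENNReal.ofReal_sum_of_nonneg fun q _ => hg0 q, ← div_eq_mul_inv, ← div_eq_mul_inv,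
          ENNReal.ofReal_div_of_pos two_pos, ENNReal.ofReal_ofNat]
    _ ≤ ENNReal.ofReal ((∑ q, (g q R - g q r)) / (2 * (R - r))) := by
        refine ENNReal.ofReal_le_ofReal ?_
        rw [mul_comm, ← div_div]
        gcongr
    _ = _ := by
        simp_rw [hvol]
        rw [← Fintype.sum_prod_type', ← ENNReal.ofReal_sum_of_nonneg fun q _ => hgR q,
          ENNReal.ofReal_div_of_pos (by positivity)]
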